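/- Let n = 2r be an integer divisible by 4 and let F be a field with char F ≠ 2. The F-algebra homomorphism from F[Y_{ij} : 1 ≤ i, j ≤ n] to F[X_{ij} : 1 ≤ i, j ≤ n] sending each Y_{ij} to the (i,j) entry of the matrix product JX induces a well-defined F-algebra isomorphism F[V] → F[W]. -/

import Mathlib

open scoped Matrix

noncomputable section

namespace PR

/-- The polynomial ring `R[Y_{ij} : 1 ≤ i, j ≤ n]`, `n = 2r`. -/
abbrev PolyRing (r : ℕ) (R : Type*) [CommRing R] :=
  MvPolynomial (Fin (2 * r) × Fin (2 * r)) R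

/-- The standard symplectic form matrix `J` (`n = 2r`). -/
def Jmat (r : ℕ) (R : Type*) [CommRing R] : Matrix (Fin (2 * r)) (Fin (2 * r)) R :=
  Matrix.of fun i j =>
    if (j : ℕ) = (i : ℕ) + r then 1 else if (i : ℕ) = (j : ℕ) + r then -1 else 0

/-- The generic `n × n` matrix of indeterminates. -/
def Ygen (r : ℕ) (R : Type*) [CommRing R] :
    Matrix (Fin (2 * r)) (Fin (2 * r)) (MvPolynomial (Fin (2 * r) × Fin (2 * r)) R) :=
  Matrix.of fun i j => MvPolynomial.X (i, j)

/-- The defining ideal of the scheme `V`. -/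
def VIdeal (r : ℕ) (R : Type*) [CommRing R] :
    Ideal (MvPolynomial (Fin (2 * r) × Fin (2 * r)) R) :=
  Ideal.span
    ({p | ∃ i j, p = (Ygen r R + (Ygen r R)ᵀ) i j} ∪
     {p | ∃ i, p = Ygen r R i i} ∪
     {p | ∃ i j, p = ((Ygen r R)ᵀ * Jmat r (PolyRing r R) * Ygen r R) i j} ∪
     {p | ∃ k, p = (Matrix.charpoly (-(Jmat r (PolyRing r R) * Ygen r R)) - Polynomial.X ^ (2 * r)).coeff k})

/-- The coordinate ring `R[V]`. -/
abbrev FV (r : ℕ) (R : Type*) [CommRing R] :=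
  MvPolynomial (Fin (2 * r) × Fin (2 * r)) R ⧸ VIdeal r R

/-- The pfaffian of an `m × m` matrix (nonzero only for even `m`), defined as a signed sum over
permutations `σ` with `σ(2i-1) < σ(2i)` for each pair and `σ(1) < σ(3) < ⋯` (here 0-indexed). -/
def pf {m : ℕ} {R : Type*} [CommRing R] (A : Matrix (Fin m) (Fin m) R) : R :=
  ∑ σ ∈ Finset.univ.filter (fun σ : Equiv.Perm (Fin m) =>
      (∀ i : Fin (m / 2),
        σ ⟨2 * i.val, by have := i.isLt; omega⟩ < σ ⟨2 * i.val + 1, by have := i.isLt; omega⟩) ∧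
      ∀ i j : Fin (m / 2), i < j →
        σ ⟨2 * i.val, by have := i.isLt; omega⟩ < σ ⟨2 * j.val, by have := j.isLt; omega⟩),
    (Equiv.Perm.sign σ : ℤ) •
      ∏ i : Fin (m / 2),
        A (σ ⟨2 * i.val, by have := i.isLt; omega⟩) (σ ⟨2 * i.val + 1, by have := i.isLt; omega⟩)

/-- `[i₁, …, i₂ₗ]`: the pfaffian of the submatrix of `Y` given by a list of indices. -/
def listPf {n : ℕ} {R : Type*} [CommRing R] (Y : Matrix (Fin n) (Fin n) R)
    (L : List (Fin n)) : R :=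
  pf (Matrix.of fun a b : Fin L.length => Y (L.get a) (L.get b))

/-- The product of pfaffians associated to a tableau (rows as lists of entries),
as a polynomial. -/
def tabPoly (r : ℕ) (R : Type*) [CommRing R] (T : List (List (Fin (2 * r)))) :
    MvPolynomial (Fin (2 * r) × Fin (2 * r)) R :=
  (T.map (listPf (Ygen r R))).prod

/-- `[T]`, the class of the product of pfaffians of the rows of `T` in `R[V]`. -/
def tabElem (r : ℕ) (R : Type*) [CommRing R] (T : List (List (Fin (2 * r)))) : FV r R :=
  Ideal.Quotient.mk (VIdeal r R) (tabPoly r R T)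

/-- Position of an index in the order `1̄ ≺ 1 ≺ 2̄ ≺ 2 ≺ ⋯ ≺ r̄ ≺ r`, where `ī := r + i`
(0-indexed: `ī` is `r + i - 1` and `i` is `i - 1`). -/
def ordIdx (r : ℕ) (x : Fin (2 * r)) : ℕ :=
  if x.val < r then 2 * x.val + 1 else 2 * (x.val - r)

/-- A list of rows represents a tableau of shape a partition: row lengths weakly decreasing
and positive. -/
def IsShape {α : Type*} (T : List (List α)) : Prop :=
  (T.map List.length).Chain' (fun a b => b ≤ a) ∧ ∀ row ∈ T, row ≠ []

/-- An even-tableau: every row has even length. -/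
def IsEvenTab {α : Type*} (T : List (List α)) : Prop :=
  ∀ row ∈ T, Even row.length

/-- Standard: entries strictly increase along each row and weakly increase down each column,
with respect to the order `≺`. -/
def IsStandard (r : ℕ) (T : List (List (Fin (2 * r)))) : Prop :=
  (∀ row ∈ T, row.Chain' (fun a b => ordIdx r a < ordIdx r b)) ∧
  ∀ (i t : ℕ) (hi : i + 1 < T.length) (ht' : t < (T[i]'(Nat.lt_of_succ_lt hi)).length)
    (ht : t < (T[i + 1]'hi).length),
    ordIdx r ((T[i]'(Nat.lt_of_succ_lt hi))[t]'ht') ≤ ordIdx r ((T[i + 1]'hi)[t]'ht)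

/-- The symplectic condition: the entries `p` and `p̄` (0-indexed: values `p` and `r + p`
for `p < r`) occur only in the first `p + 1` columns (0-indexed: columns `t ≤ p`). -/
def IsSymplectic (r : ℕ) (T : List (List (Fin (2 * r)))) : Prop :=
  ∀ (i t : ℕ) (hi : i < T.length) (ht : t < (T[i]'hi).length) (p : ℕ), p < r →
    (((T[i]'hi)[t]'ht).val = p ∨ ((T[i]'hi)[t]'ht).val = r + p) → t ≤ p

/-- A symplectic standard even-tableau. -/
def IsSSET (r : ℕ) (T : List (List (Fin (2 * r)))) : Prop :=
  IsShape T ∧ IsEvenTab T ∧ IsStandard r T ∧ IsSymplectic r T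

/-- A canonical tableau: in column `j` only `j̄` appears (0-indexed: column `t` contains
only the value `r + t`). -/
def IsCanonical (r : ℕ) (T : List (List (Fin (2 * r)))) : Prop :=
  ∀ (i t : ℕ) (hi : i < T.length) (ht : t < (T[i]'hi).length), ((T[i]'hi)[t]'ht).val = r + t

/-- The set `V(C)` of matrices. -/
def MemV (r : ℕ) {C : Type*} [CommRing C] (Y : Matrix (Fin (2 * r)) (Fin (2 * r)) C) : Prop :=
  Y = -Yᵀ ∧ (∀ i, Y i i = 0) ∧ Yᵀ * Jmat r C * Y = 0 ∧
    Matrix.charpoly (-(Jmat r C * Y)) = Polynomial.X ^ (2 * r)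

/-- The embedding `i ↦ i` of `{1, …, r}` into `{1, …, n}`. -/
def emb (r : ℕ) (i : Fin r) : Fin (2 * r) := ⟨i.val, by have := i.isLt; omega⟩

/-- The embedding `i ↦ ī = r + i` of `{1, …, r}` into `{1, …, n}`. -/
def embBar (r : ℕ) (i : Fin r) : Fin (2 * r) := ⟨r + i.val, by have := i.isLt; omega⟩

/-- The index list of `[P, Q̄]`: with `Γ₀ = P ∩ Q = {γ₁ < ⋯ < γ_λ}`, the list
`γ₁, γ̄₁, …, γ_λ, γ̄_λ` followed by `P ∖ Γ₀` in increasing order and then the bars of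
`Q ∖ Γ₀` in increasing order. -/
def pqList (r : ℕ) (P Q : Finset (Fin r)) : List (Fin (2 * r)) :=
  ((P ∩ Q).sort (· ≤ ·)).flatMap (fun γ => [emb r γ, embBar r γ]) ++
    ((P \ Q).sort (· ≤ ·)).map (emb r) ++ ((Q \ P).sort (· ≤ ·)).map (embBar r)

/-- The pfaffian `[P, Q̄]` of the matrix `Y`. -/
def pfPQ (r : ℕ) {C : Type*} [CommRing C] (Y : Matrix (Fin (2 * r)) (Fin (2 * r)) C)
    (P Q : Finset (Fin r)) : C :=
  listPf Y (pqList r P Q)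

/-- The defining ideal of the scheme `W`. -/
def WIdeal (r : ℕ) (R : Type*) [CommRing R] : Ideal (PolyRing r R) :=
  Ideal.span
    ({p | ∃ i j, p = (Jmat r (PolyRing r R) * (Ygen r R)ᵀ * Jmat r (PolyRing r R)
            + Ygen r R) i j} ∪
     {p | ∃ i j, p = (Ygen r R * Ygen r R) i j} ∪
     {p | ∃ k, p = (Matrix.charpoly (Ygen r R) - Polynomial.X ^ (2 * r)).coeff k})

/-- The coordinate ring `R[W]`. -/
abbrev FW (r : ℕ) (R : Type*) [CommRing R] := PolyRing r R ⧸ WIdeal r R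

theorem Jmat_transpose (r : ℕ) (R : Type*) [CommRing R] : (Jmat r R)ᵀ = -Jmat r R := by
  ext i j
  simp only [Jmat, Matrix.transpose_apply, Matrix.of_apply, Matrix.neg_apply]
  have := i.isLt
  have := j.isLt
  split_ifs <;> first | omega | simp

theorem Jmat_mul_Jmat (r : ℕ) (R : Type*) [CommRing R] : Jmat r R * Jmat r R = -1 := by
  ext i j
  have hi := i.isLt
  have hj := j.isLt
  rw [Matrix.mul_apply]
  by_cases h : (i : ℕ) < r
  · rw [Finset.sum_eq_single (⟨i + r, by omega⟩ : Fin (2 * r))]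
    · simp only [Jmat, Matrix.of_apply, Matrix.neg_apply, Matrix.one_apply, Fin.ext_iff]
      split_ifs <;> first | omega | simp
    · intro k _ hk
      replace hk := Fin.val_ne_of_ne hk
      dsimp only at hk
      simp only [Jmat, Matrix.of_apply]
      split_ifs <;> first | omega | simp_all
    · simp
  · rw [Finset.sum_eq_single (⟨i - r, by omega⟩ : Fin (2 * r))]
    · simp only [Jmat, Matrix.of_apply, Matrix.neg_apply, Matrix.one_apply, Fin.ext_iff]
      split_ifs <;> first | omega | simp
    · intro k _ hk
      replace hk := Fin.val_ne_of_ne hk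
      dsimp only at hk
      have := k.isLt
      simp only [Jmat, Matrix.of_apply]
      split_ifs <;> first | omega | simp
    · simp

theorem Jmat_mul_Jmat_mul {r : ℕ} {R : Type*} [CommRing R]
    (M : Matrix (Fin (2 * r)) (Fin (2 * r)) R) : Jmat r R * (Jmat r R * M) = -M := by
  rw [← Matrix.mul_assoc, Jmat_mul_Jmat, Matrix.neg_mul, Matrix.one_mul]

theorem Jmat_map {r : ℕ} {R S : Type*} [CommRing R] [CommRing S] (f : R →+* S) :
    (Jmat r R).map f = Jmat r S := by
  ext i j
  simp only [Jmat, Matrix.map_apply, Matrix.of_apply]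
  split_ifs <;> simp

/-- The set `W(C)` of matrices. -/
def MemW (r : ℕ) {C : Type*} [CommRing C] (X : Matrix (Fin (2 * r)) (Fin (2 * r)) C) : Prop :=
  Jmat r C * Xᵀ * Jmat r C + X = 0 ∧ X * X = 0 ∧ X.charpoly = Polynomial.X ^ (2 * r)

theorem MemV.memW {r : ℕ} {C : Type*} [CommRing C] {Y : Matrix (Fin (2 * r)) (Fin (2 * r)) C}
    (h : MemV r Y) : MemW r (-(Jmat r C * Y)) := by
  obtain ⟨hskew, -, hiso, hchar⟩ := h
  have hYt : Yᵀ = -Y := by rw [eq_neg_iff_add_eq_zero, add_comm, ← eq_neg_iff_add_eq_zero, ← hskew]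
  refine ⟨?_, ?_, hchar⟩
  · rw [Matrix.transpose_neg, Matrix.transpose_mul, Jmat_transpose, hYt]
    simp only [Matrix.neg_mul, Matrix.mul_neg, Matrix.mul_assoc, Jmat_mul_Jmat, neg_neg,
      Matrix.mul_one, add_neg_cancel]
  · rw [hYt] at hiso
    have hYJY : Y * (Jmat r C * Y) = 0 := by
      simpa only [Matrix.neg_mul, neg_eq_zero, Matrix.mul_assoc] using hiso
    rw [neg_mul_neg, Matrix.mul_assoc, hYJY, Matrix.mul_zero]

theorem MemW.memV {r : ℕ} {C : Type*} [CommRing C] (h2 : IsUnit (2 : C))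
    {X : Matrix (Fin (2 * r)) (Fin (2 * r)) C} (h : MemW r X) : MemV r (Jmat r C * X) := by
  obtain ⟨hadj, hsq, hchar⟩ := h
  have hXJ : Xᵀ * Jmat r C = Jmat r C * X := by
    have := congrArg (Jmat r C * ·) hadj
    simpa only [Matrix.mul_add, Matrix.mul_assoc, Jmat_mul_Jmat_mul, Matrix.mul_zero,
      neg_add_eq_zero] using this
  have hskew : Jmat r C * X = -(Jmat r C * X)ᵀ := by
    rw [Matrix.transpose_mul, Jmat_transpose, Matrix.mul_neg, neg_neg, hXJ]
  refine ⟨hskew, fun i ↦ ?_, ?_, ?_⟩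
  · have hii : (Jmat r C * X) i i = -(Jmat r C * X) i i := congrFun (congrFun hskew i) i
    rw [← h2.mul_right_eq_zero, two_mul]
    exact eq_neg_iff_add_eq_zero.mp hii
  · rw [Matrix.transpose_mul, Jmat_transpose, Matrix.mul_neg, hXJ]
    simp only [Matrix.neg_mul, Matrix.mul_assoc, Jmat_mul_Jmat_mul, Matrix.mul_neg, hsq, neg_zero,
      Matrix.mul_zero]
  · rwa [Jmat_mul_Jmat_mul, neg_neg]

section Points

variable {r : ℕ} {R A : Type*} [CommRing R] [CommRing A]

theorem VIdeal_le_ker_iff (f : PolyRing r R →+* A) :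
    VIdeal r R ≤ RingHom.ker f ↔ MemV r ((Ygen r R).map f) := by
  rw [VIdeal, Ideal.span_le, Set.union_subset_iff, Set.union_subset_iff, Set.union_subset_iff,
    and_assoc, and_assoc, MemV]
  refine and_congr ?_ (and_congr ?_ (and_congr ?_ ?_))
  · rw [eq_neg_iff_add_eq_zero, ← Matrix.ext_iff]
    exact ⟨fun h i j ↦ by simpa using h ⟨i, j, rfl⟩,
      by rintro h _ ⟨i, j, rfl⟩; simpa using h i j⟩
  · exact ⟨fun h i ↦ by simpa using h ⟨i, rfl⟩, by rintro h _ ⟨i, rfl⟩; simpa using h i⟩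
  · rw [← Jmat_map f, ← Matrix.transpose_map, ← Matrix.map_mul, ← Matrix.map_mul, ← Matrix.ext_iff]
    exact ⟨fun h i j ↦ h ⟨i, j, rfl⟩, by rintro h _ ⟨i, j, rfl⟩; exact h i j⟩
  · rw [← Jmat_map f, ← Matrix.map_mul, ← Matrix.map_neg _ (map_neg f), Matrix.charpoly_map,
      ← sub_eq_zero, Polynomial.ext_iff]
    exact ⟨fun h k ↦ by simpa [Polynomial.coeff_X_pow, apply_ite f] using h ⟨k, rfl⟩,
      by rintro h _ ⟨k, rfl⟩; simpa [Polynomial.coeff_X_pow, apply_ite f] using h k⟩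

theorem WIdeal_le_ker_iff (f : PolyRing r R →+* A) :
    WIdeal r R ≤ RingHom.ker f ↔ MemW r ((Ygen r R).map f) := by
  rw [WIdeal, Ideal.span_le, Set.union_subset_iff, Set.union_subset_iff, and_assoc, MemW]
  refine and_congr ?_ (and_congr ?_ ?_)
  · rw [← Jmat_map f, ← Matrix.transpose_map, ← Matrix.map_mul, ← Matrix.map_mul,
      ← Matrix.map_add _ (map_add f), ← Matrix.ext_iff]
    exact ⟨fun h i j ↦ h ⟨i, j, rfl⟩, by rintro h _ ⟨i, j, rfl⟩; exact h i j⟩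
  · rw [← Matrix.map_mul, ← Matrix.ext_iff]
    exact ⟨fun h i j ↦ h ⟨i, j, rfl⟩, by rintro h _ ⟨i, j, rfl⟩; exact h i j⟩
  · rw [Matrix.charpoly_map, ← sub_eq_zero, Polynomial.ext_iff]
    exact ⟨fun h k ↦ by simpa [Polynomial.coeff_X_pow, apply_ite f] using h ⟨k, rfl⟩,
      by rintro h _ ⟨k, rfl⟩; simpa [Polynomial.coeff_X_pow, apply_ite f] using h k⟩

/-- The point of affine matrix space with coordinates `M`. -/
def evalMat (R : Type*) [CommRing R] [Algebra R A] (M : Matrix (Fin (2 * r)) (Fin (2 * r)) A) :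
    PolyRing r R →ₐ[R] A :=
  MvPolynomial.aeval fun q ↦ M q.1 q.2

theorem Ygen_map_evalMat [Algebra R A] (M : Matrix (Fin (2 * r)) (Fin (2 * r)) A) :
    (Ygen r R).map (evalMat R M : PolyRing r R →+* A) = M := by
  ext i j
  simp [Ygen, evalMat]

end Points

/-- The comorphism of `W → V`, `X ↦ J X`. -/
def FVToFW (r : ℕ) (R : Type*) [CommRing R] (h2 : IsUnit (2 : FW r R)) : FV r R →ₐ[R] FW r R :=
  Ideal.Quotient.liftₐ (VIdeal r R)
    (evalMat R (Jmat r (FW r R) * (Ygen r R).map (Ideal.Quotient.mk (WIdeal r R))))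
    ((VIdeal_le_ker_iff _).mpr (by
      erw [Ygen_map_evalMat]
      exact ((WIdeal_le_ker_iff _).mp Ideal.mk_ker.ge).memV h2))

/-- The comorphism of `V → W`, `Y ↦ -J Y`. -/
def FWToFV (r : ℕ) (R : Type*) [CommRing R] : FW r R →ₐ[R] FV r R :=
  Ideal.Quotient.liftₐ (WIdeal r R)
    (evalMat R (-(Jmat r (FV r R) * (Ygen r R).map (Ideal.Quotient.mk (VIdeal r R)))))
    ((WIdeal_le_ker_iff _).mpr (by
      erw [Ygen_map_evalMat]
      exact ((VIdeal_le_ker_iff _).mp Ideal.mk_ker.ge).memW))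

theorem Ygen_map_FVToFW (r : ℕ) (R : Type*) [CommRing R] (h2 : IsUnit (2 : FW r R)) :
    ((Ygen r R).map (Ideal.Quotient.mk (VIdeal r R))).map (FVToFW r R h2 : FV r R →+* FW r R) =
      Jmat r (FW r R) * (Ygen r R).map (Ideal.Quotient.mk (WIdeal r R)) :=
  Ygen_map_evalMat (R := R) _

theorem Ygen_map_FWToFV (r : ℕ) (R : Type*) [CommRing R] :
    ((Ygen r R).map (Ideal.Quotient.mk (WIdeal r R))).map (FWToFV r R : FW r R →+* FV r R) =
      -(Jmat r (FV r R) * (Ygen r R).map (Ideal.Quotient.mk (VIdeal r R))) :=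
  Ygen_map_evalMat (R := R) _

/-- `R[V]` and `R[W]` are isomorphic when `2` is invertible. -/
def FVEquivFW (r : ℕ) (R : Type*) [CommRing R] (h2 : IsUnit (2 : FW r R)) :
    FV r R ≃ₐ[R] FW r R :=
  AlgEquiv.ofAlgHom (FVToFW r R h2) (FWToFV r R)
    (by
      have h := congrArg (fun M ↦ Matrix.map M (FVToFW r R h2 : FV r R →+* FW r R))
        (Ygen_map_FWToFV r R)
      simp only [Matrix.map_neg _ (map_neg (FVToFW r R h2 : FV r R →+* FW r R)), Matrix.map_mul,
        Jmat_map, Ygen_map_FVToFW, Jmat_mul_Jmat_mul, neg_neg] at h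
      apply Ideal.Quotient.algHom_ext
      ext q
      exact congrFun (congrFun h q.1) q.2)
    (by
      have h := congrArg (fun M ↦ Matrix.map M (FWToFV r R : FW r R →+* FV r R))
        (Ygen_map_FVToFW r R h2)
      simp only [Matrix.map_mul, Jmat_map, Ygen_map_FWToFV, Matrix.mul_neg, Jmat_mul_Jmat_mul,
        neg_neg] at h
      apply Ideal.Quotient.algHom_ext
      ext q
      exact congrFun (congrFun h q.1) q.2)

/-- For `n = 2r` divisible by 4 and `char F ≠ 2`, the `F`-algebra map
`Y_{ij} ↦ (J·X)_{ij}` induces a well-defined `F`-algebra isomorphism `F[V] → F[W]`. -/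
theorem FV_algEquiv_FW (r : ℕ) (h4 : 4 ∣ 2 * r) (F : Type*) [Field F]
    (hchar : ringChar F ≠ 2) :
    ∃ ψ : FV r F ≃ₐ[F] FW r F,
      ∀ p : PolyRing r F,
        ψ (Ideal.Quotient.mk (VIdeal r F) p) =
          Ideal.Quotient.mk (WIdeal r F)
            (MvPolynomial.aeval
              (fun q : Fin (2 * r) × Fin (2 * r) =>
                (Jmat r (PolyRing r F) * Ygen r F) q.1 q.2) p) := by
  have h2 : IsUnit (2 : FW r F) := by
    have h : IsUnit (2 : F) := (Ring.two_ne_zero hchar).isUnit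
    rw [← map_ofNat (algebraMap F (FW r F)) 2]
    exact h.map _
  refine ⟨FVEquivFW r F h2, fun p ↦ ?_⟩
  suffices h : (FVToFW r F h2).comp (Ideal.Quotient.mkₐ F (VIdeal r F)) =
      (Ideal.Quotient.mkₐ F (WIdeal r F)).comp (MvPolynomial.aeval
        fun q : Fin (2 * r) × Fin (2 * r) ↦ (Jmat r (PolyRing r F) * Ygen r F) q.1 q.2) from
    DFunLike.congr_fun h p
  ext q
  have h := Ygen_map_FVToFW r F h2
  rw [← Jmat_map (Ideal.Quotient.mk (WIdeal r F)), ← Matrix.map_mul] at h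
  simpa [Ygen] using congrFun (congrFun h q.1) q.2

end PR
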